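/- Supposing agents bid sincerely and all utilities are 0 or 1, the Balanced Like mechanism is envy free ex ante: for all agents i and i', the expected utility of agent i for their own random allocated set of items is at least the expected utility of agent i for the random set of items allocated to agent i'. -/

import Mathlib

open Finset

/-- The set of agents bidding for an item with bid vector `bid`. -/
def bidders {k : ℕ} (bid : Fin k → Bool) : Finset (Fin k) :=
  Finset.univ.filter (fun i => bid i = true)

/-- The number of items among those arriving strictly before item `j`
that allocation `A` gives to agent `i`. -/
def countsBefore {k m : ℕ} (A : Fin m → Option (Fin k)) (j : Fin m) (i : Fin k) : ℕ :=
  (Finset.univ.filter (fun j' : Fin m => j' < j ∧ A j' = some i)).card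

/-- Probability that the Balanced Like mechanism makes decision `a` for a single item
with bid vector `bid`, given that agent `i` currently holds `cnt i` items:
uniform among the bidders holding the fewest items, and `none` iff there is no bidder. -/
def blStep {k : ℕ} (bid : Fin k → Bool) (cnt : Fin k → ℕ) (a : Option (Fin k)) : ℚ :=
  match a with
  | none => if bidders bid = ∅ then 1 else 0
  | some i =>
      if i ∈ (bidders bid).filter (fun i0 => ∀ i' ∈ bidders bid, cnt i0 ≤ cnt i') then
        (((bidders bid).filter (fun i0 => ∀ i' ∈ bidders bid, cnt i0 ≤ cnt i')).card : ℚ)⁻¹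
      else 0

/-- Probability that the Balanced Like mechanism, with bid profile `b` and the items
arriving in the order `0, 1, …, m-1`, produces the allocation `A`. -/
def blProb {k m : ℕ} (b : Fin k → Fin m → Bool) (A : Fin m → Option (Fin k)) : ℚ :=
  ∏ j : Fin m, blStep (fun i => b i j) (countsBefore A j) (A j)

/-- Utility of agent `i` for the set of items that `A` allocates to agent `i'`. -/
def bundleUtil {k m : ℕ} (u : Fin k → Fin m → ℚ) (A : Fin m → Option (Fin k))
    (i i' : Fin k) : ℚ :=
  ∑ j : Fin m, if A j = some i' then u i j else 0

/-- Expected utility of agent `i` under the Balanced Like mechanism with bid profile `b`. -/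
def blEU {k m : ℕ} (u : Fin k → Fin m → ℚ) (b : Fin k → Fin m → Bool) (i : Fin k) : ℚ :=
  ∑ A : Fin m → Option (Fin k), blProb b A * bundleUtil u A i i

/-- The sincere bid profile: bid for exactly the items of positive utility. -/
def sincere {k m : ℕ} (u : Fin k → Fin m → ℚ) : Fin k → Fin m → Bool :=
  fun i j => decide (0 < u i j)

/-- Number of agents bidding for item `j` under bid profile `b`. -/
def likeQ {k m : ℕ} (b : Fin k → Fin m → Bool) (j : Fin m) : ℕ :=
  (Finset.univ.filter (fun i => b i j = true)).card

/-- Expected utility of agent `i` under the Like mechanism with bid profile `b`. -/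
def likeEU {k m : ℕ} (u : Fin k → Fin m → ℚ) (b : Fin k → Fin m → Bool) (i : Fin k) : ℚ :=
  ∑ j : Fin m, if b i j then u i j / (likeQ b j : ℚ) else 0

/-- Probability that the Like mechanism with bid profile `b` produces allocation `A`. -/
def likeProb {k m : ℕ} (b : Fin k → Fin m → Bool) (A : Fin m → Option (Fin k)) : ℚ :=
  ∏ j : Fin m,
    match A j with
    | none => if bidders (fun i => b i j) = ∅ then 1 else 0
    | some i => if b i j then ((likeQ b j : ℚ))⁻¹ else 0

/-- `b` is a pure Nash equilibrium of the Like mechanism. -/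
def LikePNE {k m : ℕ} (u : Fin k → Fin m → ℚ) (b : Fin k → Fin m → Bool) : Prop :=
  ∀ (i : Fin k) (b' : Fin m → Bool),
    likeEU u (Function.update b i b') i ≤ likeEU u b i

/-- `b` is a pure Nash equilibrium of the Balanced Like mechanism. -/
def BLPNE {k m : ℕ} (u : Fin k → Fin m → ℚ) (b : Fin k → Fin m → Bool) : Prop :=
  ∀ (i : Fin k) (b' : Fin m → Bool),
    blEU u (Function.update b i b') i ≤ blEU u b i

/-- `b` is a simple pure Nash equilibrium of the Balanced Like mechanism: every unilateral
deviation either yields strictly less expected utility, or yields equal expected utility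
while bidding for at least as many items. -/
def BLSimplePNE {k m : ℕ} (u : Fin k → Fin m → ℚ) (b : Fin k → Fin m → Bool) : Prop :=
  ∀ (i : Fin k) (b' : Fin m → Bool),
    blEU u (Function.update b i b') i < blEU u b i ∨
    (blEU u (Function.update b i b') i = blEU u b i ∧
      (Finset.univ.filter (fun j => b i j = true)).card ≤
        (Finset.univ.filter (fun j => b' j = true)).card)

/-- Minimum over the (nonempty) set of agents. -/
def minAgents {k : ℕ} (hk : 0 < k) (f : Fin k → ℚ) : ℚ :=
  Finset.univ.inf' (Finset.univ_nonempty_iff.mpr (Fin.pos_iff_nonempty.mp hk)) f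

/-- Egalitarian welfare of allocation `A`. -/
def egalAlloc {k m : ℕ} (hk : 0 < k) (u : Fin k → Fin m → ℚ)
    (A : Fin m → Option (Fin k)) : ℚ :=
  minAgents hk (fun i => bundleUtil u A i i)

/-- Utilitarian welfare of allocation `A`. -/
def utilAlloc {k m : ℕ} (u : Fin k → Fin m → ℚ) (A : Fin m → Option (Fin k)) : ℚ :=
  ∑ i : Fin k, bundleUtil u A i i

/-- Expected (ex post) egalitarian welfare of the Balanced Like mechanism under bids `b`. -/
def blExpEgal {k m : ℕ} (hk : 0 < k) (u : Fin k → Fin m → ℚ)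
    (b : Fin k → Fin m → Bool) : ℚ :=
  ∑ A : Fin m → Option (Fin k), blProb b A * egalAlloc hk u A

/-- Holdings after the decision `a` for one item. -/
def bump {k : ℕ} (n : Fin k → ℕ) (a : Option (Fin k)) (x : Fin k) : ℕ :=
  n x + if a = some x then 1 else 0

/-- The bidders holding the fewest items. -/
def leastBidders {k : ℕ} (bid : Fin k → Bool) (n : Fin k → ℕ) : Finset (Fin k) :=
  (bidders bid).filter (fun i0 => ∀ i' ∈ bidders bid, n i0 ≤ n i')

/-- Change in the utility advantage of `i` over `i'`, in the eyes of `i`, caused by the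
decision `a` for an item that `i` likes iff `likes` holds. -/
def advantage {k : ℕ} (i i' : Fin k) (likes : Bool) (a : Option (Fin k)) : ℚ :=
  if likes then (if a = some i then 1 else 0) - (if a = some i' then 1 else 0) else 0

/-- Expected total advantage of `i` over `i'` when the mechanism starts from holdings `n`. -/
def expAdvantage {k : ℕ} (i i' : Fin k) :
    (m : ℕ) → (Fin k → Fin m → Bool) → (Fin k → ℕ) → ℚ
  | 0, _, _ => 0
  | m + 1, b, n => ∑ a : Option (Fin k), blStep (fun x => b x 0) n a *
      (advantage i i' (b i 0) a + expAdvantage i i' m (fun x j => b x j.succ) (bump n a))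

/-- `blProb` with initial holdings `n`. -/
def blProbFrom {k m : ℕ} (b : Fin k → Fin m → Bool) (n : Fin k → ℕ)
    (A : Fin m → Option (Fin k)) : ℚ :=
  ∏ j : Fin m, blStep (fun i => b i j) (fun x => n x + countsBefore A j x) (A j)

theorem mem_leastBidders {k : ℕ} {bid : Fin k → Bool} {n : Fin k → ℕ} {x : Fin k} :
    x ∈ leastBidders bid n ↔ bid x = true ∧ ∀ y, bid y = true → n x ≤ n y := by
  simp [leastBidders, bidders]

theorem leastBidders_nonempty {k : ℕ} {bid : Fin k → Bool} (n : Fin k → ℕ)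
    (h : bidders bid ≠ ∅) : (leastBidders bid n).Nonempty := by
  obtain ⟨x, hx, hmin⟩ := (bidders bid).exists_min_image n (nonempty_iff_ne_empty.mpr h)
  exact ⟨x, mem_filter.mpr ⟨hx, hmin⟩⟩

theorem sum_blStep_of_empty {k : ℕ} {bid : Fin k → Bool} (n : Fin k → ℕ)
    (φ : Option (Fin k) → ℚ) (h : bidders bid = ∅) :
    ∑ a, blStep bid n a * φ a = φ none := by
  rw [Fintype.sum_option]
  simp [blStep, h]

theorem sum_blStep_of_ne_empty {k : ℕ} {bid : Fin k → Bool} (n : Fin k → ℕ)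
    (φ : Option (Fin k) → ℚ) (h : bidders bid ≠ ∅) :
    ∑ a, blStep bid n a * φ a =
      (∑ l ∈ leastBidders bid n, φ (some l)) / ((leastBidders bid n).card : ℚ) := by
  rw [Fintype.sum_option]
  simp only [blStep, if_neg h, zero_mul, zero_add, ite_mul]
  rw [← sum_filter, div_eq_inv_mul, mul_sum]
  refine sum_congr ?_ fun _ _ => rfl
  ext x
  simp [leastBidders]

theorem sum_blStep {k : ℕ} (bid : Fin k → Bool) (n : Fin k → ℕ) :
    ∑ a, blStep bid n a = 1 := by
  by_cases h : bidders bid = ∅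
  · simpa using sum_blStep_of_empty n (fun _ => 1) h
  · have hc : ((leastBidders bid n).card : ℚ) ≠ 0 := by
      exact_mod_cast (leastBidders_nonempty n h).card_pos.ne'
    simpa [hc] using sum_blStep_of_ne_empty n (fun _ => 1) h

theorem countsBefore_cons_zero {k m : ℕ} (a : Option (Fin k)) (A : Fin m → Option (Fin k))
    (x : Fin k) : countsBefore (Fin.cons a A : Fin (m + 1) → Option (Fin k)) 0 x = 0 := by
  simp [countsBefore]

theorem countsBefore_cons_succ {k m : ℕ} (a : Option (Fin k)) (A : Fin m → Option (Fin k))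
    (j : Fin m) (x : Fin k) :
    countsBefore (Fin.cons a A : Fin (m + 1) → Option (Fin k)) j.succ x =
      (if a = some x then 1 else 0) + countsBefore A j x := by
  simp only [countsBefore, card_filter, Fin.sum_univ_succ]
  simp

theorem blProbFrom_cons {k m : ℕ} (b : Fin k → Fin (m + 1) → Bool) (n : Fin k → ℕ)
    (a : Option (Fin k)) (A : Fin m → Option (Fin k)) :
    blProbFrom b n (Fin.cons a A : Fin (m + 1) → Option (Fin k)) =
      blStep (fun x => b x 0) n a * blProbFrom (fun x j => b x j.succ) (bump n a) A := by
  simp only [blProbFrom, Fin.prod_univ_succ, countsBefore_cons_zero, countsBefore_cons_succ,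
    Fin.cons_zero, Fin.cons_succ, bump, add_zero, add_assoc]

theorem sum_fin_succ_fun {α : Type*} [Fintype α] {m : ℕ} (f : (Fin (m + 1) → α) → ℚ) :
    ∑ A, f A = ∑ a, ∑ A : Fin m → α, f (Fin.cons a A : Fin (m + 1) → α) := by
  rw [← (Fin.consEquiv fun _ : Fin (m + 1) => α).sum_comp, Fintype.sum_prod_type]
  rfl

theorem sum_blProbFrom {k : ℕ} : ∀ (m : ℕ) (b : Fin k → Fin m → Bool) (n : Fin k → ℕ),
    ∑ A, blProbFrom b n A = 1
  | 0, b, n => by simp [blProbFrom]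
  | m + 1, b, n => by
    simp only [sum_fin_succ_fun, blProbFrom_cons, ← mul_sum, sum_blProbFrom m, mul_one, sum_blStep]

theorem sum_blProbFrom_mul_advantage {k : ℕ} (i i' : Fin k) :
    ∀ (m : ℕ) (b : Fin k → Fin m → Bool) (n : Fin k → ℕ),
      ∑ A, blProbFrom b n A * ∑ j, advantage i i' (b i j) (A j) = expAdvantage i i' m b n
  | 0, b, n => by simp [expAdvantage]
  | m + 1, b, n => by
    simp only [sum_fin_succ_fun, blProbFrom_cons, Fin.sum_univ_succ, Fin.cons_zero, Fin.cons_succ,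
      expAdvantage]
    refine sum_congr rfl fun a _ => ?_
    rw [← sum_blProbFrom_mul_advantage i i' m]
    simp only [mul_assoc, ← mul_sum, mul_add, sum_add_distrib, ← sum_mul, sum_blProbFrom, one_mul]

theorem leastBidders_eq_of_notMem {k : ℕ} {bid : Fin k → Bool} {n n' : Fin k → ℕ} {x : Fin k}
    (hx : n' x = n x + 1) (hne : ∀ y, bid y = true → y ≠ x → n' y = n y)
    (hM : x ∉ leastBidders bid n) : leastBidders bid n' = leastBidders bid n := by
  ext l
  by_cases hb : bid x = true
  · obtain ⟨y, hy, hyx⟩ : ∃ y, bid y = true ∧ n y < n x := by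
      by_contra! h
      exact hM (mem_leastBidders.mpr ⟨hb, h⟩)
    rw [mem_leastBidders, mem_leastBidders]
    grind
  · rw [mem_leastBidders, mem_leastBidders]
    grind

theorem leastBidders_eq_erase {k : ℕ} {bid : Fin k → Bool} {n n' : Fin k → ℕ} {x : Fin k}
    (hx : n' x = n x + 1) (hne : ∀ y, bid y = true → y ≠ x → n' y = n y)
    (hM : x ∈ leastBidders bid n) (hM' : leastBidders bid n ≠ {x}) :
    leastBidders bid n' = (leastBidders bid n).erase x := by
  obtain ⟨y, hy, hyx⟩ : ∃ y ∈ leastBidders bid n, y ≠ x := by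
    by_contra! h
    exact hM' (eq_singleton_iff_unique_mem.mpr ⟨hM, h⟩)
  ext l
  rw [mem_leastBidders] at hM hy
  rw [mem_erase, mem_leastBidders, mem_leastBidders]
  grind

theorem le_sum_blStep {k : ℕ} {bid : Fin k → Bool} {n : Fin k → ℕ}
    {φ : Option (Fin k) → ℚ} {c : ℚ} (h0 : bidders bid = ∅ → c ≤ φ none)
    (h : ∀ l ∈ leastBidders bid n, c ≤ φ (some l)) : c ≤ ∑ a, blStep bid n a * φ a := by
  by_cases hS : bidders bid = ∅
  · exact (h0 hS).trans_eq (sum_blStep_of_empty n φ hS).symm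
  · rw [sum_blStep_of_ne_empty n φ hS, le_div_iff₀
      (by exact_mod_cast (leastBidders_nonempty n hS).card_pos)]
    simpa [mul_comm] using card_nsmul_le_sum _ _ c h

theorem sum_blStep_add_nonneg_of_perm {k : ℕ} {bid : Fin k → Bool} {n n' : Fin k → ℕ}
    {φ φ' : Option (Fin k) → ℚ} (e : Equiv.Perm (Fin k)) (h0 : 0 ≤ φ none + φ' none)
    (hM : ∀ l, l ∈ leastBidders bid n ↔ e l ∈ leastBidders bid n')
    (h : ∀ l ∈ leastBidders bid n, 0 ≤ φ (some l) + φ' (some (e l))) :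
    0 ≤ ∑ a, blStep bid n a * φ a + ∑ a, blStep bid n' a * φ' a := by
  by_cases hS : bidders bid = ∅
  · rwa [sum_blStep_of_empty n φ hS, sum_blStep_of_empty n' φ' hS]
  · rw [sum_blStep_of_ne_empty n φ hS, sum_blStep_of_ne_empty n' φ' hS,
      ← card_equiv e hM, ← sum_equiv e (f := fun l => φ' (some (e l))) hM (fun _ _ => rfl),
      ← add_div, ← sum_add_distrib]
    exact div_nonneg (sum_nonneg h) (Nat.cast_nonneg _)

theorem sum_blStep_add_nonneg_of_erase {k : ℕ} {bid : Fin k → Bool} {n n' : Fin k → ℕ}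
    {φ φ' : Option (Fin k) → ℚ} {x : Fin k} {c : ℚ} (hx : x ∈ leastBidders bid n)
    (he : leastBidders bid n' = (leastBidders bid n).erase x)
    (hφx : c ≤ φ (some x)) (hφ' : ∀ l ∈ leastBidders bid n', -c ≤ φ' (some l))
    (h : ∀ l ∈ leastBidders bid n', 0 ≤ φ (some l) + φ' (some l)) :
    0 ≤ ∑ a, blStep bid n a * φ a + ∑ a, blStep bid n' a * φ' a := by
  have hS : bidders bid ≠ ∅ := ne_empty_of_mem (mem_of_mem_filter x hx)
  have hq := (leastBidders_nonempty n' hS).card_pos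
  rw [sum_blStep_of_ne_empty n φ hS, sum_blStep_of_ne_empty n' φ' hS, ← add_sum_erase _ _ hx,
    ← card_erase_add_one hx, ← he]
  have h1 := sum_nonneg h
  have h2 := card_nsmul_le_sum _ _ _ hφ'
  rw [sum_add_distrib] at h1
  rw [nsmul_eq_mul] at h2
  push_cast
  have hq' : (0 : ℚ) < ((leastBidders bid n').card : ℚ) := by exact_mod_cast hq
  generalize ((leastBidders bid n').card : ℚ) = q at *
  generalize ∑ l ∈ leastBidders bid n', φ (some l) = X at *
  generalize ∑ l ∈ leastBidders bid n', φ' (some l) = Y at *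
  rw [div_add_div _ _ (by positivity) (by positivity)]
  apply div_nonneg _ (by positivity)
  nlinarith

theorem bump_none {k : ℕ} (n : Fin k → ℕ) : bump n none = n := by
  ext x
  simp [bump]

theorem bump_comp_perm {k : ℕ} (n : Fin k → ℕ) (e : Equiv.Perm (Fin k)) (l : Fin k) :
    bump (n ∘ e) (some l) = bump n (some (e l)) ∘ e := by
  ext x
  simp [bump]

theorem min_le_sum_blStep {k : ℕ} {i i' : Fin k} (hii : i ≠ i') (bid : Fin k → Bool)
    {F : (Fin k → ℕ) → ℚ} (hF : ∀ n : Fin k → ℕ, min 0 ((n i' : ℚ) - n i) ≤ F n)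
    (hF' : ∀ n : Fin k → ℕ, n i' = n i + 1 → 0 ≤ F n + F (n ∘ Equiv.swap i i'))
    (n : Fin k → ℕ) :
    min 0 ((n i' : ℚ) - n i) ≤
      ∑ a, blStep bid n a * (advantage i i' (bid i) a + F (bump n a)) := by
  by_cases hc : n i = n i' ∧ bid i = true ∧ bid i' = true
  · obtain ⟨hn, hb, hb'⟩ := hc
    have hsw : n ∘ Equiv.swap i i' = n := by
      ext x
      simp only [Function.comp_apply, Equiv.swap_apply_def]
      grind
    have hpair : 0 ≤ F (bump n (some i')) + F (bump n (some i)) := by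
      have h := hF' (bump n (some i')) (by simp [bump, hn, hii.symm])
      have h' := bump_comp_perm n (Equiv.swap i i') i
      rw [hsw, Equiv.swap_apply_left] at h'
      rwa [← h'] at h
    have key := sum_blStep_add_nonneg_of_perm (bid := bid) (n := n) (n' := n)
      (φ := fun a => advantage i i' (bid i) a + F (bump n a))
      (φ' := fun a => advantage i i' (bid i) a + F (bump n a)) (Equiv.swap i i')
      (by
        have := hF n
        simp [advantage, bump_none]
        simpa [hn] using this)
      (by
        intro l
        rw [mem_leastBidders, mem_leastBidders, Equiv.swap_apply_def]
        grind)
      (by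
        intro l _
        rcases eq_or_ne l i with rfl | hl
        · simp [advantage, hb, hii, hii.symm]
          linarith
        rcases eq_or_ne l i' with rfl | hl'
        · simp [advantage, hb, hii, hii.symm]
          linarith
        · have := hF (bump n (some l))
          simp [bump, hl, hl', hn] at this
          simpa [Equiv.swap_apply_of_ne_of_ne hl hl', advantage, hl, hl'] using this)
    exact (min_le_left _ _).trans (by linarith)
  · refine le_sum_blStep (fun _ => by simpa [advantage, bump_none] using hF n) fun l hl => ?_
    have h := hF (bump n (some l))
    rw [mem_leastBidders] at hl
    rcases eq_or_ne l i with rfl | hli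
    · simp [advantage, bump, hii, hl.1] at h ⊢
      grind
    rcases eq_or_ne l i' with rfl | hli'
    · simp only [not_and_or] at hc
      by_cases hb : bid i = true
      · have h1 : n l < n i := lt_of_le_of_ne (hl.2 i hb) (by grind)
        have h2 : (n l : ℚ) + 1 ≤ n i := by exact_mod_cast h1
        simp [advantage, bump, hb, hii.symm] at h ⊢
        grind
      · simp [advantage, bump, hb] at h ⊢
        grind
    · simpa [advantage, bump, hli, hli'] using h

set_option maxHeartbeats 1600000 in
theorem sum_blStep_add_swap_nonneg {k : ℕ} {i i' : Fin k} (hii : i ≠ i') (bid : Fin k → Bool)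
    {F : (Fin k → ℕ) → ℚ} (hF : ∀ n : Fin k → ℕ, min 0 ((n i' : ℚ) - n i) ≤ F n)
    (hF' : ∀ n : Fin k → ℕ, n i' = n i + 1 → 0 ≤ F n + F (n ∘ Equiv.swap i i'))
    (n : Fin k → ℕ) (hn : n i' = n i + 1) :
    0 ≤ ∑ a, blStep bid n a * (advantage i i' (bid i) a + F (bump n a)) +
      ∑ a, blStep bid (n ∘ Equiv.swap i i') a *
        (advantage i i' (bid i) a + F (bump (n ∘ Equiv.swap i i') a)) := by
  set n' := n ∘ Equiv.swap i i' with hn'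
  have hni : n' i = n i + 1 := by simp [hn', hn]
  have hni' : n' i' = n i := by simp [hn']
  have hne : ∀ y, y ≠ i → y ≠ i' → n' y = n y := fun y h h' => by
    simp [hn', Equiv.swap_apply_of_ne_of_ne h h']
  have hother : ∀ l, l ≠ i → l ≠ i' →
      0 ≤ F (bump n (some l)) ∧ -1 ≤ F (bump n' (some l)) ∧
        0 ≤ F (bump n (some l)) + F (bump n' (some l)) := by
    intro l hl hl'
    refine ⟨?_, ?_, ?_⟩
    · have := hF (bump n (some l))
      simpa [bump, hl, hl', hn] using this
    · have := hF (bump n' (some l))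
      simp [bump, hl, hl', hni, hni'] at this
      grind
    · have h := hF' (bump n (some l)) (by simp [bump, hl, hl', hn])
      have h' := bump_comp_perm n (Equiv.swap i i') l
      rw [Equiv.swap_apply_of_ne_of_ne hl hl'] at h'
      rwa [← h'] at h
  have hi : 0 ≤ F (bump n (some i)) := by
    have := hF (bump n (some i))
    simpa [bump, hii, hn] using this
  have hi' : 0 ≤ F (bump n (some i')) := by
    have := hF (bump n (some i'))
    simp [bump, hii.symm, hn] at this
    grind
  have hi2 : -2 ≤ F (bump n' (some i)) := by
    have := hF (bump n' (some i))
    simp [bump, hii, hni, hni'] at this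
    grind
  have hi2' : 0 ≤ F (bump n' (some i')) := by
    have := hF (bump n' (some i'))
    simpa [bump, hii.symm, hni, hni'] using this
  have hnone : ∀ c, 0 ≤ (advantage i i' c none + F (bump n none)) +
      (advantage i i' c none + F (bump n' none)) := fun c => by
    simpa [advantage, bump_none] using hF' n hn
  have hadv : ∀ c l, l ≠ i → l ≠ i' → advantage i i' c (some l) = 0 := fun c l h h' => by
    simp [advantage, h, h']
  have hadvi : advantage i i' true (some i) = 1 := by simp [advantage, hii]
  have hadvi' : advantage i i' true (some i') = -1 := by simp [advantage, hii.symm]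
  have hadvf : ∀ a, advantage i i' false a = 0 := fun a => by simp [advantage]
  cases hb : bid i <;> cases hb' : bid i'
  · refine sum_blStep_add_nonneg_of_perm 1 (hnone _) (fun l => ?_) (fun l hl => ?_)
    · simp only [mem_leastBidders, Equiv.Perm.coe_one, id]
      grind
    · rw [mem_leastBidders] at hl
      simp only [hadvf, Equiv.Perm.coe_one, id]
      grind
  · by_cases hM' : i' ∈ leastBidders bid n'
    · by_cases hM : leastBidders bid n' = {i'}
      · have hS : bidders bid ≠ ∅ := ne_empty_of_mem (mem_of_mem_filter i' hM')
        refine add_nonneg (le_sum_blStep (fun h => absurd h hS) fun l hl => ?_)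
          (le_sum_blStep (fun h => absurd h hS) fun l hl => ?_)
        · have := (mem_leastBidders.mp hl).1
          rw [hadvf]
          grind
        · rw [hM, mem_singleton] at hl
          rw [hadvf, hl]
          grind
      · have he := leastBidders_eq_erase (n' := n) (by omega) (by grind) hM' hM
        rw [add_comm]
        refine sum_blStep_add_nonneg_of_erase (c := 0) hM' he ?_ (fun l hl => ?_) fun l hl => ?_
        · grind
        · rw [he] at hl
          rw [mem_erase, mem_leastBidders] at hl
          grind
        · rw [he] at hl
          rw [mem_erase, mem_leastBidders] at hl
          grind
    · have he := leastBidders_eq_of_notMem (n' := n) (by omega) (by grind) hM'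
      refine sum_blStep_add_nonneg_of_perm 1 (hnone _) (fun l => by simp [he]) (fun l hl => ?_)
      rw [he] at hl
      have := mem_leastBidders.mp hl
      simp only [hadvf, Equiv.Perm.coe_one, id]
      grind
  · by_cases hM : i ∈ leastBidders bid n
    · by_cases hM1 : leastBidders bid n = {i}
      · have hS : bidders bid ≠ ∅ := ne_empty_of_mem (mem_of_mem_filter i hM)
        have h1 : 1 ≤ ∑ a, blStep bid n a * (advantage i i' true a + F (bump n a)) := by
          refine le_sum_blStep (fun h => absurd h hS) fun l hl => ?_
          rw [hM1, mem_singleton] at hl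
          rw [hl, hadvi]
          linarith
        have h2 : -1 ≤ ∑ a, blStep bid n' a * (advantage i i' true a + F (bump n' a)) := by
          refine le_sum_blStep (fun h => absurd h hS) fun l hl => ?_
          have := (mem_leastBidders.mp hl).1
          grind
        linarith
      · have he := leastBidders_eq_erase (n' := n') (by omega) (by grind) hM hM1
        refine sum_blStep_add_nonneg_of_erase (c := 1) hM he ?_ (fun l hl => ?_) fun l hl => ?_
        · grind
        · rw [he] at hl
          rw [mem_erase, mem_leastBidders] at hl
          grind
        · rw [he] at hl
          rw [mem_erase, mem_leastBidders] at hl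
          grind
    · have he := leastBidders_eq_of_notMem (n' := n') (by omega) (by grind) hM
      refine sum_blStep_add_nonneg_of_perm 1 (hnone _) (fun l => by simp [he]) (fun l hl => ?_)
      have := mem_leastBidders.mp hl
      simp only [Equiv.Perm.coe_one, id]
      grind
  · refine sum_blStep_add_nonneg_of_perm (Equiv.swap i i') (hnone _) (fun l => ?_) (fun l hl => ?_)
    · rw [mem_leastBidders, mem_leastBidders, Equiv.swap_apply_def]
      grind
    · rw [mem_leastBidders] at hl
      rw [Equiv.swap_apply_def]
      grind

theorem expAdvantage_bounds {k : ℕ} {i i' : Fin k} (hii : i ≠ i') :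
    ∀ (m : ℕ) (b : Fin k → Fin m → Bool),
      (∀ n : Fin k → ℕ, min 0 ((n i' : ℚ) - n i) ≤ expAdvantage i i' m b n) ∧
      ∀ n : Fin k → ℕ, n i' = n i + 1 →
        0 ≤ expAdvantage i i' m b n + expAdvantage i i' m b (n ∘ Equiv.swap i i')
  | 0, b => by simp [expAdvantage]
  | m + 1, b =>
    have ih := expAdvantage_bounds hii m (fun x j => b x j.succ)
    ⟨min_le_sum_blStep hii (fun x => b x 0) ih.1 ih.2,
      sum_blStep_add_swap_nonneg hii (fun x => b x 0) ih.1 ih.2⟩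

/-- With sincere bids and 0/1 utilities, the Balanced Like mechanism is envy free
ex ante: agent `i`'s expected utility for their own random bundle is at least their
expected utility for agent `i'`'s random bundle. -/
theorem balancedLike_envy_free_ex_ante (k m : ℕ) (u : Fin k → Fin m → ℚ)
    (hu : ∀ i j, u i j = 0 ∨ u i j = 1) (i i' : Fin k) :
    (∑ A : Fin m → Option (Fin k), blProb (sincere u) A * bundleUtil u A i i')
      ≤ ∑ A : Fin m → Option (Fin k), blProb (sincere u) A * bundleUtil u A i i := by
  rcases eq_or_ne i i' with rfl | hii
  · rfl
  have h := (expAdvantage_bounds hii m (sincere u)).1 (fun _ => 0)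
  rw [← sum_blProbFrom_mul_advantage] at h
  have hp : blProbFrom (sincere u) (fun _ => 0) = blProb (sincere u) := by
    ext A
    simp [blProbFrom, blProb]
  simp only [hp, Nat.cast_zero, sub_self, min_self] at h
  rw [← sub_nonneg, ← sum_sub_distrib]
  refine h.trans_eq (sum_congr rfl fun A _ => ?_)
  rw [← mul_sub, bundleUtil, bundleUtil, ← sum_sub_distrib]
  congr 1
  refine sum_congr rfl fun j _ => ?_
  rcases hu i j with hj | hj <;> simp [advantage, sincere, hj]
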